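/- Let X be a topological space admitting a compatible ultrametric, let F be a nonempty closed subset of X, and let S be a characteristic subset of [0, ∞). Then for every d ∈ Met(F) that is an ultrametric taking all its values in S, there exists D ∈ Met(X) that is an ultrametric taking all its values in S such that D(a, b) = d(a, b) for all a, b ∈ F. -/

import Mathlib

/-- `d` belongs to `Met(Y)`: it is a metric on `Y` (as a bare function) whose metric
topology coincides with the given topology of `Y`. -/
def IsCompatMetric (Y : Type*) [TopologicalSpace Y] (d : Y → Y → ℝ) : Prop :=
  (∀ x y, 0 ≤ d x y) ∧ (∀ x y, d x y = d y x) ∧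
  (∀ x y z, d x z ≤ d x y + d y z) ∧ (∀ x y, d x y = 0 ↔ x = y) ∧
  (∀ x : Y, ∀ s : Set Y, s ∈ nhds x ↔ ∃ ε > 0, {y : Y | d x y < ε} ⊆ s)

/-- A metric (as a bare function) is an ultrametric if it satisfies the strong triangle
inequality. -/
def IsUltrametricFun {Y : Type*} (d : Y → Y → ℝ) : Prop :=
  ∀ x y z : Y, d x z ≤ max (d x y) (d y z)

/-- A subset `S` of `[0, ∞)` is characteristic if `0 ∈ S` and `S` contains arbitrarily
small positive numbers. -/
def CharacteristicSet (S : Set ℝ) : Prop :=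
  S ⊆ Set.Ici 0 ∧ (0 : ℝ) ∈ S ∧ ∀ t : ℝ, 0 < t → ∃ s ∈ S, 0 < s ∧ s ≤ t

/-- For an ultrametric, the triangle inequality is automatic. -/
theorem IsCompatMetric.of_isUltrametricFun {Y : Type*} [TopologicalSpace Y] {d : Y → Y → ℝ}
    (hnonneg : ∀ x y, 0 ≤ d x y) (hsymm : ∀ x y, d x y = d y x) (hd : IsUltrametricFun d)
    (hzero : ∀ x y, d x y = 0 ↔ x = y)
    (hnhds : ∀ x : Y, ∀ s : Set Y, s ∈ nhds x ↔ ∃ ε > 0, {y : Y | d x y < ε} ⊆ s) :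
    IsCompatMetric Y d :=
  ⟨hnonneg, hsymm, fun x y z => (hd x y z).trans
    (max_le_add_of_nonneg (hnonneg x y) (hnonneg y z)), hzero, hnhds⟩

/-- A characteristic set admits a monotone gauge with values in it, continuous at `0`, which
attains its minimum on every nonempty set bounded away from `0`. -/
theorem CharacteristicSet.exists_gauge {S : Set ℝ} (hS : CharacteristicSet S) :
    ∃ φ : ℝ → ℝ, Monotone φ ∧ φ 0 = 0 ∧ (∀ t, 0 < t → 0 < φ t) ∧ (∀ t, φ t ∈ S) ∧
      (∀ ε > 0, ∃ δ > 0, ∀ t < δ, φ t < ε) ∧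
      ∀ T : Set ℝ, T.Nonempty → ∀ ε > 0, (∀ t ∈ T, ε ≤ t) → ∃ t ∈ T, ∀ t' ∈ T, φ t ≤ φ t' := by
  obtain ⟨-, hS0, hS⟩ := hS
  have hglb : IsGLB (S ∩ Set.Ioi 0) 0 := by
    refine ⟨fun x hx => le_of_lt hx.2, fun b hb => ?_⟩
    by_contra! h
    obtain ⟨s, hs, hs0, hsb⟩ := hS (b / 2) (by linarith)
    have : b ≤ s := hb ⟨hs, hs0⟩
    linarith
  obtain ⟨s, hs_anti, hs_pos, hs_lim, hs_mem⟩ := hglb.exists_seq_strictAnti_tendsto_of_notMem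
    (fun h => lt_irrefl (0 : ℝ) h.2) (by
      obtain ⟨s, hs, hs0, -⟩ := hS 1 one_pos
      exact ⟨s, hs, hs0⟩)
  refine ⟨fun t => if t ≤ 0 then 0 else s ⌊t⁻¹⌋₊, ?_, by simp, ?_, ?_, ?_, ?_⟩
  · intro a b hab
    by_cases hb : b ≤ 0
    · simp [hb, hab.trans hb]
    by_cases ha : a ≤ 0
    · simpa [ha, hb] using (hs_pos _).le
    simp only [ha, hb, if_false]
    push Not at ha
    exact hs_anti.antitone (Nat.floor_mono (inv_anti₀ ha hab))
  · intro t ht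
    simpa [ht.not_ge] using hs_pos _
  · intro t
    dsimp only
    split_ifs
    exacts [hS0, (hs_mem _).1]
  · intro ε hε
    obtain ⟨n, hn⟩ := (hs_lim.eventually_lt_const hε).exists
    refine ⟨((n : ℝ) + 1)⁻¹, by positivity, fun t ht => ?_⟩
    dsimp only
    split_ifs with h
    · exact hε
    push Not at h
    refine (hs_anti.antitone (Nat.le_floor ?_)).trans_lt hn
    have := (lt_inv_comm₀ h (by positivity)).1 ht
    linarith
  · intro T hT ε hε hTε
    have hbdd : BddAbove ((fun t : ℝ => ⌊t⁻¹⌋₊) '' T) := by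
      refine ⟨⌊ε⁻¹⌋₊, ?_⟩
      rintro _ ⟨t, ht, rfl⟩
      exact Nat.floor_mono (inv_anti₀ hε (hTε t ht))
    obtain ⟨t, ht, hmax⟩ := Nat.sSup_mem (hT.image _) hbdd
    refine ⟨t, ht, fun t' ht' => ?_⟩
    have h1 := hε.trans_le (hTε t ht)
    have h2 := hε.trans_le (hTε t' ht')
    simp only [h1.not_ge, h2.not_ge, if_false]
    refine hs_anti.antitone ?_
    simp only at hmax
    rw [hmax]
    exact le_csSup hbdd ⟨t', ht', rfl⟩

/-- An ultrametrizable space carries a compatible ultrametric with values in a given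
characteristic set for which every nonempty closed set is proximinal. -/
theorem exists_proximinal_ultrametric {X : Type*} [TopologicalSpace X]
    (hu : ∃ u : X → X → ℝ, IsCompatMetric X u ∧ IsUltrametricFun u)
    {S : Set ℝ} (hS : CharacteristicSet S) :
    ∃ v : X → X → ℝ, IsCompatMetric X v ∧ IsUltrametricFun v ∧ (∀ x y, v x y ∈ S) ∧
      ∀ F : Set X, F.Nonempty → IsClosed F → ∀ x, ∃ a ∈ F, ∀ b ∈ F, v x a ≤ v x b := by
  obtain ⟨u, ⟨hu0, hus, -, huz, hun⟩, huu⟩ := hu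
  obtain ⟨φ, hmono, hφ0, hφpos, hφS, hφlim, hφmin⟩ := hS.exists_gauge
  have hnonneg : ∀ x y, 0 ≤ φ (u x y) := fun x y => hφ0 ▸ hmono (hu0 x y)
  have hultra : IsUltrametricFun fun x y => φ (u x y) := fun x y z =>
    (hmono (huu x y z)).trans_eq hmono.map_max
  refine ⟨fun x y => φ (u x y), .of_isUltrametricFun hnonneg (fun x y => by rw [hus x y]) hultra
    (fun x y => ⟨fun h => ?_, fun h => ?_⟩) (fun x s => ?_), hultra, fun x y => hφS _, ?_⟩
  · by_contra hne
    exact (hφpos _ ((hu0 x y).lt_of_ne' fun h' => hne ((huz x y).1 h'))).ne' h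
  · rw [(huz x y).2 h, hφ0]
  · rw [hun]
    constructor
    · rintro ⟨ε, hε, h⟩
      exact ⟨φ ε, hφpos ε hε, fun y hy => h (hmono.reflect_lt hy)⟩
    · rintro ⟨ε, hε, h⟩
      obtain ⟨δ, hδ, hδε⟩ := hφlim ε hε
      exact ⟨δ, hδ, fun y hy => h (hδε _ hy)⟩
  · intro F hne hF x
    by_cases hx : x ∈ F
    · exact ⟨x, hx, fun b _ => by simpa only [(huz x x).2 rfl, hφ0] using hnonneg x b⟩
    obtain ⟨ε, hε, h⟩ := (hun x Fᶜ).1 (hF.isOpen_compl.mem_nhds hx)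
    obtain ⟨_, ⟨a, ha, rfl⟩, hmin⟩ := hφmin (u x '' F) (hne.image _) ε hε (by
      rintro _ ⟨b, hb, rfl⟩
      by_contra! hlt
      exact h hlt hb)
    exact ⟨a, ha, fun b hb => hmin _ ⟨b, hb, rfl⟩⟩

/-- If every point of the space has a nearest point in `F`, then nearest points can be chosen
consistently: points closer to each other than to `F` share their nearest point. -/
theorem exists_nearest_point_map {X : Type*} {v : X → X → ℝ} (hvs : ∀ x y, v x y = v y x)
    (hvu : IsUltrametricFun v) {F : Set X}
    (hprox : ∀ x, ∃ a ∈ F, ∀ b ∈ F, v x a ≤ v x b) :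
    ∃ r : X → F, (∀ x, ∀ b ∈ F, v x (r x) ≤ v x b) ∧
      ∀ x y, v x y < v x (r x) → r y = r x := by
  let N : X → Set F := fun x => {a | ∀ b ∈ F, v x a ≤ v x b}
  have hN : ∀ x, (N x).Nonempty := fun x =>
    let ⟨a, ha, h⟩ := hprox x
    ⟨⟨a, ha⟩, h⟩
  have hmin : ∀ x, ∀ b ∈ F, v x (hN x).some ≤ v x b := fun x => (hN x).some_mem
  refine ⟨fun x => (hN x).some, hmin, fun x y hxy => ?_⟩
  have heq : ∀ b ∈ F, v y b = v x b := by
    intro b hb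
    have hb' := hxy.trans_le (hmin x b hb)
    refine le_antisymm ((hvu y x b).trans (max_le (hvs y x ▸ hb'.le) le_rfl)) ?_
    exact (le_max_iff.1 (hvu x y b)).resolve_left hb'.not_ge
  have hset : N y = N x := by
    ext a
    exact forall₂_congr fun b hb => by rw [heq a a.2, heq b hb]
  simp only [hset]

/-- Collapsing a set, to whose points the distance is `ρ`, keeps the strong triangle
inequality. -/
theorem IsUltrametricFun.collapse {X : Type*} {v : X → X → ℝ} (hvs : ∀ x y, v x y = v y x)
    (hvu : IsUltrametricFun v) {ρ : X → ℝ} (hρ : ∀ x y, ρ x ≤ max (v x y) (ρ y)) :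
    IsUltrametricFun fun x y => min (v x y) (max (ρ x) (ρ y)) := by
  intro x y z
  have h1 := hvu x y z
  have h2 := hρ x y
  have h3 := hρ z y
  rw [hvs z y] at h3
  grind

theorem ultrametric_extension {X : Type*} [TopologicalSpace X]
    (hu : ∃ u : X → X → ℝ, IsCompatMetric X u ∧ IsUltrametricFun u)
    (F : Set X) (hFne : F.Nonempty) (hFcl : IsClosed F)
    (S : Set ℝ) (hS : CharacteristicSet S) :
    ∀ d : ↥F → ↥F → ℝ, IsCompatMetric ↥F d → IsUltrametricFun d →
      (∀ a b : ↥F, d a b ∈ S) →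
      ∃ D : X → X → ℝ, IsCompatMetric X D ∧ IsUltrametricFun D ∧
        (∀ x y : X, D x y ∈ S) ∧ ∀ a b : ↥F, D (a : X) (b : X) = d a b := by
  intro d ⟨hd0, hds, _, hdz, hdn⟩ hdu hdS
  obtain ⟨v, ⟨hv0, hvs, -, hvz, hvn⟩, hvu, hvS, hprox⟩ := exists_proximinal_ultrametric hu hS
  obtain ⟨r, hrmin, hrconst⟩ := exists_nearest_point_map hvs hvu (hprox F hFne hFcl)
  have hrF : ∀ a : F, r a = a := fun a => by
    have h := hrmin a a a.2
    rw [(hvz (a : X) a).2 rfl] at h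
    exact Subtype.ext ((hvz _ _).1 (le_antisymm h (hv0 _ _))).symm
  let ρ : X → ℝ := fun x => v x (r x)
  have hρ0 : ∀ x, 0 ≤ ρ x := fun x => hv0 _ _
  have hρ : ∀ x y, ρ x ≤ max (v x y) (ρ y) := fun x y =>
    (hrmin x _ (r y).2).trans (hvu x y _)
  have hρF : ∀ a : F, ρ a = 0 := fun a => (hvz _ _).2 (by rw [hrF])
  have hρpos : ∀ x ∉ F, 0 < ρ x := fun x hx =>
    (hρ0 x).lt_of_ne' fun h => hx ((hvz _ _).1 h ▸ (r x).2)
  let w : X → X → ℝ := fun x y => min (v x y) (max (ρ x) (ρ y))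
  have hwu : IsUltrametricFun w := hvu.collapse hvs hρ
  have hw0 : ∀ x y, 0 ≤ w x y := fun x y => le_min (hv0 x y) (le_max_of_le_left (hρ0 x))
  have hwv : ∀ x y, w x y < ρ x → w x y = v x y := fun x y h =>
    min_eq_left (not_lt.1 fun h' =>
      h.not_ge ((le_max_left _ _).trans (min_eq_right h'.le).ge))
  have hwF : ∀ (a : F) (y : X), w a y = ρ y := fun a y => by
    have h := hrmin y a a.2
    rw [hvs y a] at h
    simp only [w, hρF, max_eq_right (hρ0 y)]
    exact min_eq_right h
  let D : X → X → ℝ := fun x y => max (d (r x) (r y)) (w x y)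
  have hDu : IsUltrametricFun D := fun x y z => max_le
    ((hdu (r x) (r y) (r z)).trans (max_le_max (le_max_left _ _) (le_max_left _ _)))
    ((hwu x y z).trans (max_le_max (le_max_right _ _) (le_max_right _ _)))
  have hDF : ∀ (a : F) (y : X), D a y = max (d a (r y)) (ρ y) := fun a y => by
    simp only [D, hrF, hwF]
  have hDeq : ∀ a b : F, D a b = d a b := fun a b => by
    rw [hDF, hrF, hρF, max_eq_left (hd0 a b)]
  have hDs : ∀ x y, D x y = D y x := fun x y => by
    simp only [D, w]
    rw [hds, hvs, max_comm (ρ x)]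
  have hDn : ∀ x : X, ∀ s : Set X, s ∈ nhds x ↔ ∃ ε > 0, {y : X | D x y < ε} ⊆ s := by
    intro x s
    rw [hvn]
    by_cases hx : x ∈ F
    · lift x to F using hx
      -- the topologies of `d` and of the restriction of `v` on `F` agree
      have hball : ∀ t : Set F, (∃ ε > 0, {b : F | d x b < ε} ⊆ t) ↔
          ∃ ε > 0, {b : F | v x b < ε} ⊆ t := by
        intro t
        rw [← hdn, mem_nhds_subtype]
        constructor
        · rintro ⟨t', ht', h⟩
          obtain ⟨ε, hε, h'⟩ := (hvn _ _).1 ht'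
          exact ⟨ε, hε, fun b hb => h (h' hb)⟩
        · rintro ⟨ε, hε, h⟩
          exact ⟨{y | v x y < ε}, (hvn _ _).2 ⟨ε, hε, subset_rfl⟩, h⟩
      constructor
      · rintro ⟨ε, hε, h⟩
        obtain ⟨δ, hδ, h'⟩ := (hball {b : F | v x b < ε}).2 ⟨ε, hε, subset_rfl⟩
        refine ⟨min δ ε, lt_min hδ hε, fun y hy => h ?_⟩
        rw [Set.mem_ofPred_eq, hDF, max_lt_iff, lt_min_iff, lt_min_iff] at hy
        have hvr : v x (r y) < ε := h' hy.1.1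
        have hvy : v (r y) y < ε := by rw [hvs]; exact hy.2.2
        exact (hvu _ _ _).trans_lt (max_lt hvr hvy)
      · rintro ⟨ε, hε, h⟩
        obtain ⟨δ, hδ, h'⟩ := (hball {b : F | d x b < ε}).1 ⟨ε, hε, subset_rfl⟩
        refine ⟨min δ ε, lt_min hδ hε, fun y hy => h ?_⟩
        rw [Set.mem_ofPred_eq, lt_min_iff] at hy
        have hρy : ρ y ≤ v x y := by rw [hvs]; exact hrmin y x x.2
        have hvr : v x (r y) < δ := (hvu _ y _).trans_lt (max_lt hy.1 (hρy.trans_lt hy.1))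
        rw [Set.mem_ofPred_eq, hDF]
        exact max_lt (h' hvr) (hρy.trans_lt hy.2)
    · constructor
      · rintro ⟨ε, hε, h⟩
        refine ⟨min ε (ρ x), lt_min hε (hρpos x hx), fun y hy => h ?_⟩
        rw [Set.mem_ofPred_eq, max_lt_iff, lt_min_iff] at hy
        exact (hwv x y (lt_min_iff.1 hy.2).2).symm.trans_lt (lt_min_iff.1 hy.2).1
      · rintro ⟨ε, hε, h⟩
        refine ⟨min ε (ρ x), lt_min hε (hρpos x hx), fun y hy => h ?_⟩
        rw [Set.mem_ofPred_eq, lt_min_iff] at hy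
        refine max_lt ?_ ((min_le_left _ _).trans_lt hy.1)
        rwa [hrconst x y hy.2, (hdz _ _).2 rfl]
  have hDz : ∀ x y, D x y = 0 ↔ x = y := by
    intro x y
    constructor
    · intro h
      have hd' : d (r x) (r y) = 0 := le_antisymm ((le_max_left _ _).trans h.le) (hd0 _ _)
      have hw' : w x y = 0 := le_antisymm ((le_max_right _ _).trans h.le) (hw0 _ _)
      by_cases hx : x ∈ F
      · lift x to F using hx
        rw [hwF] at hw'
        rw [← hrF x, (hdz _ _).1 hd']
        exact ((hvz _ _).1 hw').symm
      · exact (hvz _ _).1 ((hwv x y (hw' ▸ hρpos x hx)).symm.trans hw')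
    · rintro rfl
      simp [D, w, (hdz _ _).2, (hvz _ _).2, hρ0]
  refine ⟨D, .of_isUltrametricFun (fun x y => le_max_of_le_left (hd0 _ _)) hDs hDu hDz hDn, hDu,
    fun x y => ?_, hDeq⟩
  simp only [D, w]
  rcases max_choice (d (r x) (r y)) (min (v x y) (max (ρ x) (ρ y))) with h | h <;> rw [h]
  · exact hdS _ _
  rcases min_choice (v x y) (max (ρ x) (ρ y)) with h | h <;> rw [h]
  · exact hvS _ _
  rcases max_choice (ρ x) (ρ y) with h | h <;> rw [h] <;> exact hvS _ _
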